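/- arXiv:1007.0312 — 4 statements merged into one kernel-verified Lean document; each statement's English description precedes it below -/
import Mathlib

section
/- Let α, β > 0 and γ ∈ ℝ, and set f(n) = α n^β (log n)^γ. Then for every τ ∈ ℝ, as n → ∞, u_{f(n)}(τ) = √(2β log n) + [ (γ − 1/2)·log(β log n) + log( α / (2 β^γ √π) ) + τ + o(1) ] / √(2β log n). -/
open Filter Real

/-- `u_m(τ) = √(2 log m) + (-(1/2) log log m - log(2√π) + τ)/√(2 log m)`. -/
noncomputable def uLevel (m τ : ℝ) : ℝ :=
  Real.sqrt (2 * Real.log m) +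
    (-(1 / 2) * Real.log (Real.log m) - Real.log (2 * Real.sqrt π) + τ)
      / Real.sqrt (2 * Real.log m)


theorem aux_tendsto (a γ k : ℝ) :
    Tendsto (fun x : ℝ =>
      -((a + γ * Real.log x) ^ 2 / x) / (1 + √(1 + (a + γ * Real.log x) / x)) ^ 2
      + ((a + γ * Real.log x) / x * (1 / 2 * Real.log x)
          + (a + γ * Real.log x) / x * (1 / 2 * Real.log (1 + (a + γ * Real.log x) / x) + k))
        / (√(1 + (a + γ * Real.log x) / x) * (1 + √(1 + (a + γ * Real.log x) / x)))
      - 1 / 2 * Real.log (1 + (a + γ * Real.log x) / x)) atTop (nhds 0) := by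
  have h0 : Tendsto (fun x : ℝ => 1 / x) atTop (nhds 0) := by
    simpa using tendsto_inv_atTop_zero (𝕜 := ℝ)
  have h1 : Tendsto (fun x : ℝ => Real.log x / x) atTop (nhds 0) := by
    simpa using Real.tendsto_pow_log_div_mul_add_atTop 1 0 1 one_ne_zero
  have h2 : Tendsto (fun x : ℝ => Real.log x ^ 2 / x) atTop (nhds 0) := by
    simpa using Real.tendsto_pow_log_div_mul_add_atTop 1 0 2 one_ne_zero
  have hr : Tendsto (fun x : ℝ => (a + γ * Real.log x) / x) atTop (nhds 0) := by
    have := (h0.const_mul a).add (h1.const_mul γ)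
    simp only [mul_zero, add_zero] at this
    exact this.congr fun x => by ring
  have hd : Tendsto (fun x : ℝ => (a + γ * Real.log x) ^ 2 / x) atTop (nhds 0) := by
    have := ((h0.const_mul (a ^ 2)).add (h1.const_mul (2 * a * γ))).add (h2.const_mul (γ ^ 2))
    simp only [mul_zero, add_zero] at this
    exact this.congr fun x => by ring
  have hl : Tendsto (fun x : ℝ => (a + γ * Real.log x) / x * (1 / 2 * Real.log x))
      atTop (nhds 0) := by
    have := (h1.const_mul (a / 2)).add (h2.const_mul (γ / 2))
    simp only [mul_zero, add_zero] at this
    exact this.congr fun x => by ring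
  have h1r : Tendsto (fun x : ℝ => 1 + (a + γ * Real.log x) / x) atTop (nhds 1) := by
    simpa using hr.const_add 1
  have hs : Tendsto (fun x : ℝ => √(1 + (a + γ * Real.log x) / x)) atTop (nhds 1) := by
    simpa using h1r.sqrt
  have hlog : Tendsto (fun x : ℝ => Real.log (1 + (a + γ * Real.log x) / x)) atTop (nhds 0) := by
    simpa using h1r.log one_ne_zero
  have t1 := hd.neg.div ((hs.const_add 1).pow 2) (by norm_num)
  have t2 := (hl.add (hr.mul ((hlog.const_mul (1 / 2)).add_const k))).div
    (hs.mul (hs.const_add 1)) (by norm_num)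
  have := (t1.add t2).sub (hlog.const_mul (1 / 2))
  simpa using this

theorem aux_identity (x D k : ℝ) (hx : 0 < x) (hD : 0 < 1 + D / x) :
    √(2 * (x + D)) + (-(1 / 2) * Real.log (x + D) - k) / √(2 * (x + D)) =
    √(2 * x) + ((D - 1 / 2 * Real.log x - k) +
     (-(D ^ 2 / x) / (1 + √(1 + D / x)) ^ 2
      + (D / x * (1 / 2 * Real.log x)
          + D / x * (1 / 2 * Real.log (1 + D / x) + k))
        / (√(1 + D / x) * (1 + √(1 + D / x)))
      - 1 / 2 * Real.log (1 + D / x))) / √(2 * x) := by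
  have e : x + D = x * (1 + D / x) := by field_simp
  have e2 : 2 * (x + D) = (2 * x) * (1 + D / x) := by rw [e]; ring
  rw [e2, e, Real.log_mul hx.ne' hD.ne', Real.sqrt_mul (by positivity)]
  have hs := Real.sqrt_pos.2 hD
  have hs2 := Real.sq_sqrt hD.le
  have hS : 0 < √(2 * x) := Real.sqrt_pos.2 (by positivity)
  have hS2 := Real.sq_sqrt (show 0 ≤ 2 * x by positivity)
  generalize Real.log (1 + D / x) = l at *
  generalize √(1 + D / x) = s at *
  generalize √(2 * x) = S at *
  generalize Real.log x = m at *
  have hr : D / x = s ^ 2 - 1 := by linarith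
  have hD' : D = x * (s ^ 2 - 1) := by rw [← hr]; field_simp
  have hx' : x = S ^ 2 / 2 := by linarith
  rw [hr, hD', hx']
  have : 1 + s ≠ 0 := by positivity
  field_simp
  ring


/-- Lemma 2.2: if `f(n) = α n^β (log n)^γ`, then
`u_{f(n)}(τ) = √(2β log n) + ((γ - 1/2) log(β log n) + log(α/(2β^γ √π)) + τ + o(1))/√(2β log n)`
as `n → ∞`. -/
theorem uLevel_asymptotics (α β : ℝ) (hα : 0 < α) (hβ : 0 < β) (γ τ : ℝ) :
    ∃ ε : ℕ → ℝ, Tendsto ε atTop (nhds 0) ∧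
      ∀ᶠ n : ℕ in atTop,
        uLevel (α * (n : ℝ) ^ β * Real.log n ^ γ) τ =
          Real.sqrt (2 * β * Real.log n) +
            ((γ - 1 / 2) * Real.log (β * Real.log n)
              + Real.log (α / (2 * β ^ γ * Real.sqrt π)) + τ + ε n)
              / Real.sqrt (2 * β * Real.log n) := by
  set a : ℝ := Real.log α - γ * Real.log β with ha
  set k : ℝ := Real.log (2 * √π) - τ with hk
  have hL : Tendsto (fun n : ℕ => β * Real.log n) atTop atTop :=
    (Real.tendsto_log_atTop.comp tendsto_natCast_atTop_atTop).const_mul_atTop hβ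
  refine ⟨_, (aux_tendsto a γ k).comp hL, ?_⟩
  have h1 : Tendsto (fun x : ℝ => 1 + (a + γ * Real.log x) / x) atTop (nhds 1) := by
    have h0 : Tendsto (fun x : ℝ => 1 / x) atTop (nhds 0) := by
      simpa using tendsto_inv_atTop_zero (𝕜 := ℝ)
    have h1 : Tendsto (fun x : ℝ => Real.log x / x) atTop (nhds 0) := by
      simpa using Real.tendsto_pow_log_div_mul_add_atTop 1 0 1 one_ne_zero
    have := ((h0.const_mul a).add (h1.const_mul γ)).const_add 1
    simp only [mul_zero, add_zero] at this
    exact this.congr fun x => by ring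
  filter_upwards [hL.eventually_gt_atTop 0,
    (h1.comp hL).eventually (lt_mem_nhds zero_lt_one), eventually_gt_atTop 0] with n hx hD hn
  have hn' : (0 : ℝ) < n := by exact_mod_cast hn
  have hln : 0 < Real.log n := by
    by_contra h
    nlinarith
  have hid := aux_identity (β * Real.log n) (a + γ * Real.log (β * Real.log n)) k hx hD
  have hlogf : Real.log (α * (n : ℝ) ^ β * Real.log n ^ γ)
      = β * Real.log n + (a + γ * Real.log (β * Real.log n)) := by
    rw [Real.log_mul (by positivity) (by positivity), Real.log_mul (by positivity) (by positivity),
      Real.log_rpow hn', Real.log_rpow hln, Real.log_mul hβ.ne' hln.ne', ha]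
    ring
  have hc : Real.log (α / (2 * β ^ γ * √π)) = a - Real.log (2 * √π) := by
    rw [show 2 * β ^ γ * √π = β ^ γ * (2 * √π) by ring, Real.log_div (by positivity) (by positivity),
      Real.log_mul (by positivity) (by positivity), Real.log_rpow hβ, ha]
    ring
  have e1 : -(1 / 2) * Real.log (β * Real.log n + (a + γ * Real.log (β * Real.log n)))
      - Real.log (2 * √π) + τ = -(1 / 2) * Real.log (β * Real.log n
        + (a + γ * Real.log (β * Real.log n))) - k := by rw [hk]; ring
  have e2 : (γ - 1 / 2) * Real.log (β * Real.log n) + (a - Real.log (2 * √π)) + τ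
      = a + γ * Real.log (β * Real.log n) - 1 / 2 * Real.log (β * Real.log n) - k := by
    rw [hk]; ring
  unfold uLevel
  rw [hlogf, hc, e1, e2, mul_assoc 2 β]
  exact hid
end

section
/- Under the stated assumptions, the law of the random variable W_N = Σ_{i=1}^N 1_{E_{iN}} converges as N → ∞ to the Poisson distribution with mean λ, i.e. for every integer k ≥ 0, lim_{N→∞} P[W_N = k] = e^{−λ} λ^k / k!. In particular, lim_{N→∞} P[ ∩_{i=1}^N E_{iN}^c ] = e^{−λ}. -/
open MeasureTheory ProbabilityTheory Filter Real

lemma aux_abs_measure {Ω : Type*} [MeasurableSpace Ω] (μ : Measure Ω) [IsProbabilityMeasure μ]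
    {A B D : Set Ω} (h1 : A ⊆ B ∪ D) (h2 : B ⊆ A ∪ D) : |μ.real A - μ.real B| ≤ μ.real D := by
  have e1 : μ.real A ≤ μ.real B + μ.real D :=
    (measureReal_mono h1).trans (measureReal_union_le _ _)
  have e2 : μ.real B ≤ μ.real A + μ.real D :=
    (measureReal_mono h2).trans (measureReal_union_le _ _)
  rw [abs_le]; constructor <;> linarith

/-- counting function -/
noncomputable def auxW {Ω : Type*} (E : ℕ → Set Ω) (s : Finset ℕ) (ω : Ω) : ℕ :=
  ∑ i ∈ s, (E i).indicator (fun _ => (1 : ℕ)) ω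

lemma auxW_meas {Ω : Type*} (m : MeasurableSpace Ω) (E : ℕ → Set Ω) (s : Finset ℕ)
    (h : ∀ i ∈ s, MeasurableSet (E i)) : Measurable (auxW E s) := by
  unfold auxW
  refine Finset.measurable_sum _ fun i hi => ?_
  exact measurable_const.indicator (h i hi)

lemma auxW_ne_zero {Ω : Type*} (E : ℕ → Set Ω) (s : Finset ℕ) (ω : Ω) (h : auxW E s ω ≠ 0) :
    ω ∈ ⋃ j ∈ s, E j := by
  obtain ⟨i, hi, h2⟩ := Finset.exists_ne_zero_of_sum_ne_zero h
  simp only [Set.mem_iUnion]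
  exact ⟨i, hi, Set.mem_of_indicator_ne_zero h2⟩

lemma aux_sum_inter {Ω : Type*} [MeasurableSpace Ω] (μ : Measure Ω) [IsProbabilityMeasure μ]
    (E : ℕ → Set Ω) (hE : ∀ i, MeasurableSet (E i)) (s : Finset ℕ) (A : Set Ω)
    (hA : MeasurableSet A) :
    ∑ i ∈ s, μ.real (E i ∩ A) = ∫ ω in A, (auxW E s ω : ℝ) ∂μ := by
  have : ∀ ω, (auxW E s ω : ℝ) = ∑ i ∈ s, (E i).indicator (fun _ => (1 : ℝ)) ω := by
    intro ω
    simp only [auxW, Nat.cast_sum, Set.indicator]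
    refine Finset.sum_congr rfl fun i _ => ?_
    split_ifs <;> simp
  simp_rw [this]
  rw [integral_finset_sum]
  · refine Finset.sum_congr rfl fun i _ => ?_
    rw [integral_indicator (hE i)]
    simp [measureReal_restrict_apply, hE i, Measure.restrict_restrict]
  · intro i _
    exact (integrable_const _).indicator (hE i)

lemma aux_step {Ω : Type*} [MeasurableSpace Ω] (μ : Measure Ω) [IsProbabilityMeasure μ]
    (E : ℕ → Set Ω) (hE : ∀ i, MeasurableSet (E i)) (N : ℕ) (p : ℝ)
    (hp : ∀ i ∈ Finset.range N, μ.real (E i) = p) (B : ℕ → Finset ℕ)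
    (hBsub : ∀ i, B i ⊆ Finset.range N) (hBmem : ∀ i ∈ Finset.range N, i ∈ B i) (C : ℝ)
    (hBcard : ∀ i ∈ Finset.range N, ((B i).card : ℝ) < C)
    (hind : ∀ i ∈ Finset.range N,
      Indep (MeasurableSpace.generateFrom {E i})
        (MeasurableSpace.generateFrom {s | ∃ j ∈ Finset.range N, j ∉ B i ∧ s = E j}) μ)
    (k : ℕ) :
    |((k : ℝ) + 1) * μ.real {ω | auxW E (Finset.range N) ω = k + 1}
      - N * p * μ.real {ω | auxW E (Finset.range N) ω = k}|
    ≤ (∑ i ∈ Finset.range N, ∑ j ∈ (B i).erase i, μ.real (E i ∩ E j)) + N * p * (C * p) := by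
  have hWm := auxW_meas _ E (Finset.range N) (fun i _ => hE i)
  have hA : MeasurableSet {ω | auxW E (Finset.range N) ω = k + 1} :=
    hWm (measurableSet_singleton (k + 1))
  have e1 : ((k : ℝ) + 1) * μ.real {ω | auxW E (Finset.range N) ω = k + 1}
      = ∑ i ∈ Finset.range N, μ.real (E i ∩ {ω | auxW E (Finset.range N) ω = k + 1}) := by
    rw [aux_sum_inter μ E hE _ _ hA, setIntegral_congr_fun (g := fun _ => (k : ℝ) + 1) hA]
    · simp [mul_comm]
    · intro ω hω
      simp only [Set.mem_ofPred_eq] at hω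
      simp [hω]
  have e2 : N * p * μ.real {ω | auxW E (Finset.range N) ω = k}
      = ∑ i ∈ Finset.range N, p * μ.real {ω | auxW E (Finset.range N) ω = k} := by
    simp [mul_assoc]
  have e3 : N * p * (C * p) = ∑ i ∈ Finset.range N, p * (C * p) := by simp [mul_assoc]
  rw [e1, e2, e3, ← Finset.sum_sub_distrib, ← Finset.sum_add_distrib]
  refine (Finset.abs_sum_le_sum_abs _ _).trans (Finset.sum_le_sum fun i hi => ?_)
  have hp0 : 0 ≤ p := by rw [← hp i hi]; exact measureReal_nonneg
  have hsplit : ∀ ω, auxW E (Finset.range N) ω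
      = auxW E (Finset.range N \ B i) ω + auxW E (B i) ω := fun ω =>
    (Finset.sum_sdiff (hBsub i)).symm
  have hsplit2 : ∀ ω, auxW E (B i) ω
      = auxW E ((B i).erase i) ω + (E i).indicator (fun _ => (1 : ℕ)) ω := fun ω =>
    (Finset.sum_erase_add _ _ (hBmem i hi)).symm
  have hV : μ.real (E i ∩ {ω | auxW E (Finset.range N \ B i) ω = k})
      = p * μ.real {ω | auxW E (Finset.range N \ B i) ω = k} := by
    have hVm := auxW_meas
      (MeasurableSpace.generateFrom {s | ∃ j ∈ Finset.range N, j ∉ B i ∧ s = E j}) E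
      (Finset.range N \ B i) (fun j hj => MeasurableSpace.measurableSet_generateFrom
          ⟨j, (Finset.mem_sdiff.1 hj).1, (Finset.mem_sdiff.1 hj).2, rfl⟩)
    have h := (Indep_iff _ _ μ).1 (hind i hi) (E i)
      {ω | auxW E (Finset.range N \ B i) ω = k}
      (MeasurableSpace.measurableSet_generateFrom rfl)
      (hVm (measurableSet_singleton k))
    rw [← hp i hi]
    simp only [measureReal_def, h, ENNReal.toReal_mul]
  have b1 : |μ.real (E i ∩ {ω | auxW E (Finset.range N) ω = k + 1})
      - μ.real (E i ∩ {ω | auxW E (Finset.range N \ B i) ω = k})|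
      ≤ ∑ j ∈ (B i).erase i, μ.real (E i ∩ E j) := by
    refine (aux_abs_measure μ (D := ⋃ j ∈ (B i).erase i, (E i ∩ E j)) ?_ ?_).trans
      (measureReal_biUnion_finset_le _ _)
    all_goals
      rintro ω ⟨h1, h2⟩
      simp only [Set.mem_ofPred_eq] at h2
      have a1 := hsplit ω
      have a2 := hsplit2 ω
      rw [Set.indicator_of_mem h1] at a2
      by_cases h0 : auxW E ((B i).erase i) ω = 0
      · exact Or.inl ⟨h1, by simp only [Set.mem_ofPred_eq]; omega⟩
      · right
        have := auxW_ne_zero _ _ _ h0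
        simp only [Set.mem_iUnion] at this ⊢
        obtain ⟨j, hj, hj2⟩ := this
        exact ⟨j, hj, h1, hj2⟩
  have b2 : |μ.real {ω | auxW E (Finset.range N \ B i) ω = k}
      - μ.real {ω | auxW E (Finset.range N) ω = k}| ≤ C * p := by
    have c1 : |μ.real {ω | auxW E (Finset.range N \ B i) ω = k}
      - μ.real {ω | auxW E (Finset.range N) ω = k}| ≤ ∑ j ∈ B i, μ.real (E j) := by
      refine (aux_abs_measure μ (D := ⋃ j ∈ B i, E j) ?_ ?_).trans
        (measureReal_biUnion_finset_le _ _)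
      all_goals
        intro ω h2
        simp only [Set.mem_ofPred_eq] at h2
        have a1 := hsplit ω
        by_cases h0 : auxW E (B i) ω = 0
        · left
          simp only [Set.mem_ofPred_eq]; omega
        · exact Or.inr (auxW_ne_zero _ _ _ h0)
    have c2 : ∑ j ∈ B i, μ.real (E j) = (B i).card * p := by
      rw [Finset.sum_congr rfl (fun j hj => hp j (hBsub i hj))]; simp
    rw [c2] at c1
    exact c1.trans (mul_le_mul_of_nonneg_right (hBcard i hi).le hp0)
  rw [hV] at b1
  have b3 := mul_le_mul_of_nonneg_left b2 hp0
  rw [← abs_of_nonneg hp0, ← abs_mul, abs_of_nonneg hp0] at b3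
  rw [abs_le] at *
  constructor <;> linarith [b1.1, b1.2, b3.1, b3.2]

lemma aux_tight {Ω : Type*} [MeasurableSpace Ω] (μ : Measure Ω) [IsProbabilityMeasure μ]
    (E : ℕ → Set Ω) (hE : ∀ i, MeasurableSet (E i)) (N : ℕ) (p : ℝ)
    (hp : ∀ i ∈ Finset.range N, μ.real (E i) = p) (K : ℕ) (hK : 0 < K) :
    |∑ k ∈ Finset.range K, μ.real {ω | auxW E (Finset.range N) ω = k} - 1| ≤ N * p / K := by
  have hWm := auxW_meas _ E (Finset.range N) (fun i _ => hE i)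
  have h1 : ∑ k ∈ Finset.range K, μ.real {ω | auxW E (Finset.range N) ω = k}
      = μ.real {ω | auxW E (Finset.range N) ω < K} := by
    rw [← measureReal_biUnion_finset]
    · congr 1; ext ω; simp
    · intro a _ b _ hab
      refine Set.disjoint_left.2 fun ω h1 h2 => hab ?_
      simp only [Set.mem_ofPred_eq] at h1 h2
      omega
    · intro k _
      exact hWm (measurableSet_singleton k)
  have hm : MeasurableSet {ω | auxW E (Finset.range N) ω < K} := hWm measurableSet_Iio
  have h2 := probReal_compl_eq_one_sub (μ := μ) hm
  have hmc := hm.compl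
  set A := {ω | auxW E (Finset.range N) ω < K} with hAdef
  have h3 : (K : ℝ) * μ.real Aᶜ ≤ N * p := by
    calc (K : ℝ) * μ.real Aᶜ = ∫ ω in Aᶜ, (K : ℝ) ∂μ := by simp [mul_comm]
      _ ≤ ∫ ω in Aᶜ, (auxW E (Finset.range N) ω : ℝ) ∂μ := by
        refine setIntegral_mono_on (integrable_const _) ?_ hmc ?_
        · refine Integrable.of_bound (C := N) (by fun_prop) ?_
          refine Eventually.of_forall fun ω => ?_
          simp only [Real.norm_natCast, Nat.cast_le, auxW]
          calc _ ≤ ∑ i ∈ Finset.range N, 1 := Finset.sum_le_sum fun i _ => by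
                simp only [Set.indicator]; split_ifs <;> simp
            _ = N := by simp
        · intro ω hω
          simp only [hAdef, Set.mem_compl_iff, Set.mem_ofPred_eq, not_lt] at hω
          exact_mod_cast hω
      _ = ∑ i ∈ Finset.range N, μ.real (E i ∩ Aᶜ) := (aux_sum_inter μ E hE _ _ hmc).symm
      _ ≤ ∑ i ∈ Finset.range N, p := Finset.sum_le_sum fun i hi => by
        rw [← hp i hi]; exact measureReal_mono Set.inter_subset_left
      _ = N * p := by simp
  have hK' : (0 : ℝ) < K := by exact_mod_cast hK
  have h4 : μ.real Aᶜ ≤ N * p / K := by rw [le_div_iff₀ hK']; linarith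
  rw [h1, abs_sub_comm, ← h2, abs_of_nonneg measureReal_nonneg]
  exact h4

lemma aux_seq (a : ℕ → ℕ → ℝ) (q : ℕ → ℝ) (lam : ℝ) (hlam : 0 < lam)
    (ha0 : ∀ N k, 0 ≤ a N k) (ha1 : ∀ N k, a N k ≤ 1)
    (hq : Tendsto q atTop (nhds lam))
    (hrec : ∀ k : ℕ, Tendsto (fun N => ((k : ℝ) + 1) * a N (k + 1) - q N * a N k) atTop (nhds 0))
    (ht : ∀ N K : ℕ, 0 < K → |∑ k ∈ Finset.range K, a N k - 1| ≤ q N / K) (k : ℕ) :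
    Tendsto (fun N => a N k) atTop (nhds (Real.exp (-lam) * lam ^ k / (Nat.factorial k))) := by
  have hdiff : ∀ k, Tendsto (fun N => a N k - a N 0 * (lam ^ k / Nat.factorial k)) atTop
      (nhds 0) := by
    intro k
    induction k with
    | zero => simp
    | succ k ih =>
      have hz : Tendsto (fun N => (q N - lam) * a N k) atTop (nhds 0) := by
        have : Tendsto (fun N => q N - lam) atTop (nhds 0) := by
          simpa using hq.sub_const lam
        refine squeeze_zero_norm (a := fun N => |q N - lam|) (fun N => ?_) (by simpa using this.abs)
        rw [Real.norm_eq_abs, abs_mul, abs_of_nonneg (ha0 N k)]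
        exact mul_le_of_le_one_right (abs_nonneg _) (ha1 N k)
      have h := (((hrec k).add hz).add (ih.const_mul lam)).div_const ((k : ℝ) + 1)
      simp only [mul_zero, add_zero, zero_div] at h
      refine h.congr fun N => ?_
      have : (Nat.factorial k : ℝ) ≠ 0 := by positivity
      rw [Nat.factorial_succ]
      push_cast
      field_simp
      ring
  have h0 : Tendsto (fun N => a N 0 * Real.exp lam) atTop (nhds 1) := by
    rw [Metric.tendsto_nhds]
    intro ε hε
    have hexp : Tendsto (fun K => ∑ k ∈ Finset.range K, lam ^ k / (Nat.factorial k : ℝ)) atTop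
        (nhds (Real.exp lam)) := by
      rw [Real.exp_eq_exp_ℝ]
      exact (NormedSpace.expSeries_div_hasSum_exp lam).tendsto_sum_nat
    have hinv : Tendsto (fun K : ℕ => (lam + 1) / (K : ℝ)) atTop (nhds 0) :=
      tendsto_const_div_atTop_nhds_zero_nat _
    have c1 := (Metric.tendsto_nhds.1 hexp) (ε / 3) (by positivity)
    have c2 := hinv.eventually (gt_mem_nhds (show (0 : ℝ) < ε / 3 by positivity))
    obtain ⟨K, hK1, hK2, hK3⟩ := (c1.and (c2.and (eventually_gt_atTop 0))).exists
    have d1 : Tendsto (fun N => ∑ k ∈ Finset.range K,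
        (a N k - a N 0 * (lam ^ k / Nat.factorial k))) atTop (nhds 0) := by
      simpa using tendsto_finset_sum (Finset.range K) (fun k _ => hdiff k)
    have d2 := (Metric.tendsto_nhds.1 d1) (ε / 3) (by positivity)
    have d3 := hq.eventually (gt_mem_nhds (show lam < lam + 1 by linarith))
    filter_upwards [d2, d3] with N e1 e2
    rw [Finset.sum_sub_distrib, ← Finset.mul_sum] at e1
    rw [Real.dist_eq] at *
    have e3 := ht N K hK3
    have hK' : (0 : ℝ) < K := by exact_mod_cast hK3
    have e4 : q N / K ≤ (lam + 1) / K := by gcongr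
    set S := ∑ k ∈ Finset.range K, lam ^ k / (Nat.factorial k : ℝ)
    set T := ∑ k ∈ Finset.range K, a N k
    have e5 : |a N 0 * (S - Real.exp lam)| < ε / 3 := by
      rw [abs_mul, abs_of_nonneg (ha0 N 0)]
      exact (mul_le_of_le_one_left (abs_nonneg _) (ha1 N 0)).trans_lt hK1
    have e6 : |T - 1| < ε / 3 := by linarith
    rw [sub_zero] at e1
    rw [abs_lt] at *
    constructor <;> linarith [e1.1, e1.2, e5.1, e5.2, e6.1, e6.2]
  have h0' : Tendsto (fun N => a N 0) atTop (nhds (Real.exp (-lam))) := by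
    have := h0.mul_const (Real.exp (-lam))
    simpa [mul_assoc, ← Real.exp_add] using this
  have := (hdiff k).add (h0'.mul_const (lam ^ k / Nat.factorial k))
  simpa [mul_div_assoc] using this

/-- Poisson limit theorem for finite-range dependent events: if for each `N` the events
`E N 0, …, E N (N-1)` all have probability `p N` with `N p N → λ ∈ (0,∞)`, and they are
finite-range dependent (conditions (1)–(3)), then the number of occurring events converges
in distribution to a Poisson law with mean `λ`; in particular the probability that no event
occurs converges to `e^{-λ}`. -/
theorem poisson_limit_finite_range_dependent
    {Ω : Type*} [MeasureSpace Ω] [IsProbabilityMeasure (ℙ : Measure Ω)]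
    (E : ℕ → ℕ → Set Ω) (hmeas : ∀ N i, MeasurableSet (E N i))
    (p : ℕ → ℝ) (hp : ∀ N, ∀ i ∈ Finset.range N, (ℙ (E N i)).toReal = p N)
    (lam : ℝ) (hlam : 0 < lam)
    (hNp : Tendsto (fun N : ℕ => (N : ℝ) * p N) atTop (nhds lam))
    (B : ℕ → ℕ → Finset ℕ)
    (hBsub : ∀ N i, B N i ⊆ Finset.range N)
    (hBmem : ∀ N, ∀ i ∈ Finset.range N, i ∈ B N i)
    (C : ℝ)
    (hBcard : ∀ N : ℕ, ∀ i ∈ Finset.range N, ((B N i).card : ℝ) < C)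
    (hind : ∀ N : ℕ, ∀ i ∈ Finset.range N,
      Indep (MeasurableSpace.generateFrom {E N i})
        (MeasurableSpace.generateFrom {s | ∃ j ∈ Finset.range N, j ∉ B N i ∧ s = E N j}) ℙ)
    (hcov : Tendsto
      (fun N : ℕ => ∑ i ∈ Finset.range N, ∑ j ∈ (B N i).erase i, (ℙ (E N i ∩ E N j)).toReal)
      atTop (nhds 0)) :
    (∀ k : ℕ,
      Tendsto (fun N : ℕ =>
          (ℙ {ω | (∑ i ∈ Finset.range N, (E N i).indicator (fun _ => (1 : ℕ)) ω) = k}).toReal)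
        atTop (nhds (Real.exp (-lam) * lam ^ k / (Nat.factorial k)))) ∧
    Tendsto (fun N : ℕ => (ℙ (⋂ i ∈ Finset.range N, (E N i)ᶜ)).toReal)
      atTop (nhds (Real.exp (-lam))) := by
  have hmain : ∀ k : ℕ, Tendsto (fun N : ℕ =>
      (ℙ : Measure Ω).real {ω | auxW (E N) (Finset.range N) ω = k})
      atTop (nhds (Real.exp (-lam) * lam ^ k / (Nat.factorial k))) := by
    intro k
    refine aux_seq (fun N k => (ℙ : Measure Ω).real {ω | auxW (E N) (Finset.range N) ω = k})
      (fun N => N * p N) lam hlam (fun _ _ => measureReal_nonneg) (fun _ _ => measureReal_le_one)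
      hNp ?_ (fun N K hK => aux_tight ℙ (E N) (hmeas N) N (p N) (hp N) K hK) k
    intro k
    have hp0 : Tendsto p atTop (nhds 0) := by
      have h := hNp.mul (tendsto_inv_atTop_nhds_zero_nat (𝕜 := ℝ))
      rw [mul_zero] at h
      refine h.congr' ?_
      filter_upwards [eventually_gt_atTop 0] with N hN
      have : (N : ℝ) ≠ 0 := by positivity
      field_simp
    have hb := hcov.add (hNp.mul (hp0.const_mul C))
    simp only [mul_zero, add_zero] at hb
    exact squeeze_zero_norm (fun N => aux_step ℙ (E N) (hmeas N) N (p N) (hp N) (B N) (hBsub N)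
      (hBmem N) C (hBcard N) (hind N) k) hb
  refine ⟨hmain, ?_⟩
  have h0 := hmain 0
  simp only [pow_zero, mul_one, Nat.factorial_zero, Nat.cast_one, div_one] at h0
  refine h0.congr fun N => ?_
  rw [measureReal_def]
  congr 2
  ext ω
  simp [auxW]
end

section
/- For every integer d ≥ 1, the integral G_d = ∫_0^∞ G(h; 2d) dh is finite and strictly positive, i.e. 0 < ∫_0^∞ h^{−2} F(2d/h)² dh < ∞. -/
open MeasureTheory Filter Real

/-- The standard Gaussian tail function `Φ̄(u) = (2π)^{-1/2} ∫_u^∞ e^{-w²/2} dw`. -/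
noncomputable def gaussTail (u : ℝ) : ℝ :=
  (Real.sqrt (2 * π))⁻¹ * ∫ w in Set.Ioi u, Real.exp (-w ^ 2 / 2)

/-- `F(κ) = κ^{-1} exp(-2 Σ_{n≥1} n^{-1} Φ̄(√(κ n)/2))`. -/
noncomputable def F (κ : ℝ) : ℝ :=
  κ⁻¹ * Real.exp (-2 * ∑' n : ℕ, ((n : ℝ) + 1)⁻¹ * gaussTail (Real.sqrt (κ * ((n : ℝ) + 1)) / 2))

/-- `G(h; κ) = h^{-2} F(κ/h)²`. -/
noncomputable def G (h κ : ℝ) : ℝ := ((h : ℝ) ^ 2)⁻¹ * F (κ / h) ^ 2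

lemma gt_integrable : Integrable (fun w : ℝ => Real.exp (-w ^ 2 / 2)) := by
  have h := integrable_exp_neg_mul_sq (b := 1 / 2) (by norm_num)
  refine h.congr (Eventually.of_forall fun x => ?_)
  simp only
  congr 1
  ring

lemma gt_nonneg (u : ℝ) : 0 ≤ gaussTail u := by
  unfold gaussTail
  have : 0 ≤ ∫ w in Set.Ioi u, Real.exp (-w ^ 2 / 2) :=
    integral_nonneg fun _ => (Real.exp_pos _).le
  positivity

lemma gt_anti {u v : ℝ} (h : u ≤ v) : gaussTail v ≤ gaussTail u := by
  unfold gaussTail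
  apply mul_le_mul_of_nonneg_left _ (by positivity)
  apply setIntegral_mono_set gt_integrable.integrableOn
  · exact Eventually.of_forall fun _ => (Real.exp_pos _).le
  · exact (Set.Ioi_subset_Ioi h).eventuallyLE

lemma gt_zero : gaussTail 0 = 1 / 2 := by
  unfold gaussTail
  have h := integral_gaussian_Ioi (1 / 2)
  have e : ∀ w : ℝ, Real.exp (-w ^ 2 / 2) = Real.exp (-(1 / 2) * w ^ 2) := by
    intro w; congr 1; ring
  simp_rw [e]
  rw [h]
  have : π / (1 / 2) = 2 * π := by ring
  rw [this]
  have : 0 < √(2 * π) := by positivity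
  field_simp

lemma gt_inv_le : (√(2 * π))⁻¹ ≤ 1 / 2 := by
  have h : (2 : ℝ) ≤ √(2 * π) := by
    apply Real.le_sqrt_of_sq_le
    nlinarith [Real.pi_gt_three]
  rw [one_div]
  exact inv_anti₀ (by norm_num) h

lemma gt_lower {u : ℝ} (h0 : 0 ≤ u) (h1 : u ≤ 1 / 4) : 3 / 8 ≤ gaussTail u := by
  have hz := gt_zero
  unfold gaussTail at hz ⊢
  have hs : ∫ w in Set.Ioi (0 : ℝ), Real.exp (-w ^ 2 / 2) =
      (∫ w in Set.Ioc 0 u, Real.exp (-w ^ 2 / 2)) +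
        ∫ w in Set.Ioi u, Real.exp (-w ^ 2 / 2) := by
    rw [← Set.Ioc_union_Ioi_eq_Ioi h0]
    exact setIntegral_union (Set.Ioc_disjoint_Ioi le_rfl) measurableSet_Ioi
      gt_integrable.integrableOn gt_integrable.integrableOn
  have hb : (∫ w in Set.Ioc 0 u, Real.exp (-w ^ 2 / 2)) ≤ u := by
    have : (∫ w in Set.Ioc 0 u, Real.exp (-w ^ 2 / 2)) ≤ ∫ w in Set.Ioc 0 u, (1 : ℝ) := by
      apply setIntegral_mono gt_integrable.integrableOn
      · exact integrableOn_const (by simp)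
      · intro w
        simp only
        rw [Real.exp_le_one_iff]
        nlinarith [sq_nonneg w]
    simpa [h0] using this
  rw [hs, mul_add] at hz
  have := mul_le_mul gt_inv_le (hb.trans h1)
    (integral_nonneg fun _ => (Real.exp_pos _).le) (by norm_num)
  linarith

lemma gt_upper {u : ℝ} (h0 : 0 < u) : gaussTail u ≤ Real.exp (1 / 2) / u := by
  have h1 : (∫ w in Set.Ioi u, Real.exp (-w ^ 2 / 2)) ≤
      ∫ w in Set.Ioi u, Real.exp (1 / 2) * Real.exp (-w) := by
    apply setIntegral_mono gt_integrable.integrableOn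
    · exact (integrableOn_exp_neg_Ioi u).const_mul _
    · intro w
      simp only
      rw [← Real.exp_add]
      apply Real.exp_le_exp.2
      nlinarith [sq_nonneg (w - 1)]
  rw [integral_const_mul, integral_exp_neg_Ioi] at h1
  have h2 : Real.exp (-u) ≤ u⁻¹ := by
    rw [Real.exp_neg]
    exact inv_anti₀ h0 (by linarith [Real.add_one_le_exp u])
  have h3 : Real.exp (1 / 2) * Real.exp (-u) ≤ Real.exp (1 / 2) / u := by
    rw [div_eq_mul_inv _ u]
    exact mul_le_mul_of_nonneg_left h2 (Real.exp_pos _).le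
  unfold gaussTail
  have h4 : 0 ≤ ∫ w in Set.Ioi u, Real.exp (-w ^ 2 / 2) :=
    integral_nonneg fun _ => (Real.exp_pos _).le
  have := mul_le_mul_of_nonneg_right gt_inv_le h4
  linarith

noncomputable def St (κ : ℝ) (n : ℕ) : ℝ :=
  ((n : ℝ) + 1)⁻¹ * gaussTail (Real.sqrt (κ * ((n : ℝ) + 1)) / 2)

lemma St_nonneg (κ : ℝ) (n : ℕ) : 0 ≤ St κ n :=
  mul_nonneg (by positivity) (gt_nonneg _)

lemma St_summable {κ : ℝ} (hκ : 0 < κ) : Summable (St κ) := by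
  have hs : Summable (fun n : ℕ => (((n + 1 : ℕ) : ℝ) ^ (3 / 2 : ℝ))⁻¹) :=
    (summable_nat_add_iff 1).2 (Real.summable_nat_rpow_inv.2 (by norm_num : (1 : ℝ) < 3 / 2))
  refine Summable.of_nonneg_of_le (St_nonneg κ) (fun n => ?_)
    (hs.mul_left (2 * Real.exp (1 / 2) / √κ))
  have hn : (0 : ℝ) < (n : ℝ) + 1 := by positivity
  have hk : 0 < √κ := Real.sqrt_pos.2 hκ
  have hq : 0 < √((n : ℝ) + 1) := Real.sqrt_pos.2 hn
  have h := gt_upper (u := √(κ * ((n : ℝ) + 1)) / 2) (by positivity)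
  have e : (((n + 1 : ℕ) : ℝ) ^ (3 / 2 : ℝ)) = ((n : ℝ) + 1) * √((n : ℝ) + 1) := by
    push_cast
    rw [show (3 / 2 : ℝ) = 1 + 1 / 2 by norm_num, Real.rpow_add hn, Real.rpow_one,
      Real.sqrt_eq_rpow]
  rw [e]
  unfold St
  refine (mul_le_mul_of_nonneg_left h (by positivity)).trans_eq ?_
  rw [Real.sqrt_mul hκ.le]
  field_simp

lemma St_sum_anti {κ κ' : ℝ} (hκ : 0 < κ) (h : κ ≤ κ') : ∑' n, St κ' n ≤ ∑' n, St κ n := by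
  refine (St_summable (hκ.trans_le h)).tsum_le_tsum (fun n => ?_) (St_summable hκ)
  unfold St
  refine mul_le_mul_of_nonneg_left (gt_anti ?_) (by positivity)
  gcongr

lemma St_sum_lower {κ : ℝ} (hκ : 0 < κ) : 3 / 8 * Real.log (1 / (4 * κ)) ≤ ∑' n, St κ n := by
  set N := ⌊1 / (4 * κ)⌋₊ with hN
  have h1 : ∑ n ∈ Finset.range N, St κ n ≤ ∑' n, St κ n :=
    (St_summable hκ).sum_le_tsum _ (fun n _ => St_nonneg κ n)
  have h2 : ∑ n ∈ Finset.range N, 3 / 8 * ((n : ℝ) + 1)⁻¹ ≤ ∑ n ∈ Finset.range N, St κ n := by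
    refine Finset.sum_le_sum fun n hn => ?_
    have hn' : n + 1 ≤ N := Finset.mem_range.1 hn
    have h3 : ((n + 1 : ℕ) : ℝ) ≤ 1 / (4 * κ) :=
      (Nat.le_floor_iff (by positivity)).1 hn'
    push_cast at h3
    rw [le_div_iff₀ (by positivity)] at h3
    have h4 : √(κ * ((n : ℝ) + 1)) ≤ 1 / 2 := by
      apply Real.sqrt_le_iff.2
      constructor
      · norm_num
      · nlinarith
    unfold St
    rw [mul_comm]
    exact mul_le_mul_of_nonneg_left (gt_lower (by positivity) (by linarith)) (by positivity)
  have h5 := log_add_one_le_harmonic N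
  have h6 : ((harmonic N : ℚ) : ℝ) = ∑ n ∈ Finset.range N, ((n : ℝ) + 1)⁻¹ := by
    simp [harmonic]
  rw [← Finset.mul_sum, ← h6] at h2
  have h7 : Real.log (1 / (4 * κ)) ≤ Real.log ((N : ℝ) + 1) := by
    apply Real.log_le_log (by positivity)
    exact (Nat.lt_floor_add_one _).le
  push_cast at h5
  linarith

lemma G_eq {h κ : ℝ} (hh : 0 < h) (hκ : 0 < κ) :
    G h κ = (κ ^ 2)⁻¹ * Real.exp (-4 * ∑' n, St (κ / h) n) := by
  have : F (κ / h) = (κ / h)⁻¹ * Real.exp (-2 * ∑' n, St (κ / h) n) := rfl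
  unfold G
  rw [this, mul_pow, ← Real.exp_nat_mul]
  have e : ((2 : ℕ) : ℝ) * (-2 * ∑' n, St (κ / h) n) = -4 * ∑' n, St (κ / h) n := by
    push_cast; ring
  rw [e]
  field_simp

/-- Part of Lemma 4.5: the constant `G_d = ∫_0^∞ G(h; 2d) dh` is finite and strictly
positive. -/
theorem Gconst_finite_pos (d : ℕ) (hd : 1 ≤ d) :
    IntegrableOn (fun h : ℝ => G h (2 * d)) (Set.Ioi (0 : ℝ)) volume ∧
      0 < ∫ h in Set.Ioi (0 : ℝ), G h (2 * d) := by
  have hκ : (0 : ℝ) < 2 * d := by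
    have : (0 : ℝ) < d := by exact_mod_cast hd
    positivity
  generalize (2 * d : ℝ) = κ at hκ
  have hpos : ∀ h ∈ Set.Ioi (0 : ℝ), 0 < G h κ := by
    intro h hh
    rw [G_eq hh hκ]
    positivity
  have hanti : AntitoneOn (fun h : ℝ => G h κ) (Set.Ioi 0) := by
    intro a ha b hb hab
    have ha' : 0 < a := ha
    have hb' : 0 < b := hb
    simp only
    rw [G_eq ha hκ, G_eq hb hκ]
    have := St_sum_anti (κ := κ / b) (κ' := κ / a) (by positivity) (by gcongr)
    refine mul_le_mul_of_nonneg_left (Real.exp_le_exp.2 ?_) (by positivity)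
    linarith
  have hm := aemeasurable_restrict_of_antitoneOn (μ := volume) measurableSet_Ioi hanti
  have hb1 : ∀ h ∈ Set.Ioi (0 : ℝ), G h κ ≤ (κ ^ 2)⁻¹ := by
    intro h hh
    rw [G_eq hh hκ]
    have : Real.exp (-4 * ∑' n, St (κ / h) n) ≤ 1 := by
      rw [Real.exp_le_one_iff]
      have : 0 ≤ ∑' n, St (κ / h) n := tsum_nonneg (St_nonneg _)
      linarith
    exact mul_le_of_le_one_right (by positivity) this
  have hb2 : ∀ h ∈ Set.Ioi (0 : ℝ),
      G h κ ≤ (κ ^ 2)⁻¹ * (1 / (4 * κ)) ^ (-(3 / 2) : ℝ) * h ^ (-(3 / 2) : ℝ) := by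
    intro h hh
    have hh' : 0 < h := hh
    rw [G_eq hh hκ, mul_assoc, ← Real.mul_rpow (by positivity) hh'.le]
    refine mul_le_mul_of_nonneg_left ?_ (by positivity)
    rw [Real.rpow_def_of_pos (by positivity)]
    apply Real.exp_le_exp.2
    have := St_sum_lower (κ := κ / h) (by positivity)
    have e : 1 / (4 * (κ / h)) = 1 / (4 * κ) * h := by field_simp
    rw [e] at this
    linarith
  have hI : IntegrableOn (fun h : ℝ => G h κ) (Set.Ioi (0 : ℝ)) volume := by
    rw [← Set.Ioc_union_Ioi_eq_Ioi (zero_le_one : (0 : ℝ) ≤ 1)]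
    have s1 : Set.Ioc (0 : ℝ) 1 ⊆ Set.Ioi 0 := Set.Ioc_subset_Ioi_self
    have s2 : Set.Ioi (1 : ℝ) ⊆ Set.Ioi 0 := Set.Ioi_subset_Ioi zero_le_one
    refine IntegrableOn.union ?_ ?_
    · refine Integrable.mono' (g := fun _ => (κ ^ 2)⁻¹) (integrableOn_const (by simp))
        (hm.mono_set s1).aestronglyMeasurable ?_
      refine (ae_restrict_iff' measurableSet_Ioc).2 (Eventually.of_forall fun h hh => ?_)
      rw [Real.norm_of_nonneg (hpos h (s1 hh)).le]
      exact hb1 h (s1 hh)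
    · refine Integrable.mono' ((integrableOn_Ioi_rpow_of_lt
        (by norm_num : (-(3 / 2) : ℝ) < -1) zero_lt_one).const_mul
          ((κ ^ 2)⁻¹ * (1 / (4 * κ)) ^ (-(3 / 2) : ℝ)))
        (hm.mono_set s2).aestronglyMeasurable ?_
      refine (ae_restrict_iff' measurableSet_Ioi).2 (Eventually.of_forall fun h hh => ?_)
      rw [Real.norm_of_nonneg (hpos h (s2 hh)).le]
      exact hb2 h (s2 hh)
  refine ⟨hI, ?_⟩
  rw [setIntegral_pos_iff_support_of_nonneg_ae _ hI]
  · have : Function.support (fun h : ℝ => G h κ) ∩ Set.Ioi 0 = Set.Ioi 0 :=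
      Set.inter_eq_right.2 fun h hh => (hpos h hh).ne'
    rw [this]
    simp
  · exact (ae_restrict_iff' measurableSet_Ioi).2
      (Eventually.of_forall fun h hh => (hpos h hh).le)
end

section
/- One has lim_{κ ↓ 0} F(κ) = 1/2. Consequently, for every integer d ≥ 1, G(h; 2d) ∼ 1/(4h²) as h → +∞, i.e. lim_{h→∞} h² G(h; 2d) = 1/4. -/
open MeasureTheory Filter Real

/-- The (unnormalised) Gamma(1/2) density. -/
noncomputable def gd (u : ℝ) : ℝ := Real.exp (-u) * u ^ ((1 / 2 : ℝ) - 1)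

lemma gd_integrable : IntegrableOn gd (Set.Ioi 0) :=
  Real.GammaIntegral_convergent (by norm_num)

lemma gd_nonneg {u : ℝ} (hu : 0 < u) : 0 ≤ gd u := by unfold gd; positivity

lemma gd_integral : ∫ u in Set.Ioi (0:ℝ), gd u = √π := by
  rw [← Real.Gamma_one_half_eq, Real.Gamma_eq_integral (by norm_num)]
  rfl

lemma gd_log_integral :
    ∫ u in Set.Ioi (0:ℝ), Real.log u * gd u = -√π * (eulerMascheroniConstant + 2 * Real.log 2) := by
  have h1 := Complex.hasDerivAt_GammaIntegral (s := (1 / 2 : ℂ)) (by norm_num)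
  have h2 : HasDerivAt Complex.GammaIntegral
      (-√π * (eulerMascheroniConstant + 2 * Real.log 2) : ℂ) (1 / 2 : ℂ) := by
    have := Complex.hasDerivAt_Gamma_one_half
    have h3 : HasDerivAt Complex.Gamma
      (-√π * (eulerMascheroniConstant + 2 * Real.log 2) : ℂ) (1 / 2 : ℂ) := by
      convert this using 3
      simp
    refine h3.congr_of_eventuallyEq ?_
    have : {s : ℂ | 0 < s.re} ∈ nhds (1 / 2 : ℂ) :=
      (isOpen_lt continuous_const Complex.continuous_re).mem_nhds (by norm_num)
    filter_upwards [this] with s hs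
    exact (Complex.Gamma_eq_integral hs).symm
  have h4 := h1.unique h2
  have h5 : ((∫ u in Set.Ioi (0:ℝ), Real.log u * gd u : ℝ) : ℂ) =
      ∫ t : ℝ in Set.Ioi 0, (t:ℂ) ^ ((1/2:ℂ) - 1) * (Real.log t * Real.exp (-t)) := by
    rw [← integral_complex_ofReal]
    refine setIntegral_congr_fun measurableSet_Ioi ?_
    intro t ht
    have ht : (0:ℝ) < t := ht
    simp only [gd]
    push_cast
    rw [Complex.ofReal_cpow ht.le]
    push_cast
    ring
  rw [h4] at h5
  exact_mod_cast h5

lemma gd_log_integrable : IntegrableOn (fun u => Real.log u * gd u) (Set.Ioi 0) := by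
  apply Integrable.of_integral_ne_zero
  rw [gd_log_integral]
  have h1 : 0 < √π := by positivity
  have h2 := Real.one_half_lt_eulerMascheroniConstant
  have h3 : 0 < Real.log 2 := Real.log_pos (by norm_num)
  have : 0 < √π * (eulerMascheroniConstant + 2 * Real.log 2) := by
    apply mul_pos h1; linarith
  linarith

lemma gaussTail_eq {x : ℝ} (hx : 0 < x) :
    2 * gaussTail (√x / 2) = (√π)⁻¹ * ∫ u in Set.Ioi (x / 8), gd u := by
  set a := √x / 2 with ha
  have ha0 : 0 < a := by positivity
  have hfa : a ^ 2 / 2 = x / 8 := by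
    rw [ha, div_pow, Real.sq_sqrt hx.le]; ring
  have hg : ContinuousOn gd (Set.Ioi 0) := by
    intro u hu
    have hu : (0:ℝ) < u := hu
    unfold gd
    apply ContinuousAt.continuousWithinAt
    fun_prop (disch := first | positivity | exact Or.inl hu.ne')
  have key : ∀ w ∈ Set.Ioi a, gd (w ^ 2 / 2) * w = √2 * Real.exp (-w ^ 2 / 2) := by
    intro w hw
    have hw : 0 < w := ha0.trans hw
    have : (w ^ 2 / 2) ^ ((1 / 2 : ℝ) - 1) = √2 / w := by
      rw [show (1/2:ℝ) - 1 = -(1/2) by norm_num, Real.rpow_neg (by positivity),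
        ← Real.sqrt_eq_rpow, Real.sqrt_div (by positivity), Real.sqrt_sq hw.le, inv_div]
    simp only [gd, this]
    rw [neg_div]
    field_simp
  have hint : Integrable (fun w : ℝ => Real.exp (-w ^ 2 / 2)) := by
    have := integrable_exp_neg_mul_sq (b := 1 / 2) (by norm_num)
    refine this.congr (Eventually.of_forall fun w => ?_)
    simp only
    congr 1; ring
  have sub := integral_comp_mul_deriv_Ioi (a := a) (f := fun w : ℝ => w ^ 2 / 2)
    (f' := fun w => w) (g := gd) (by fun_prop)
    ((tendsto_pow_atTop (by norm_num)).atTop_div_const (by norm_num))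
    (fun w _ => by
      have := ((hasDerivAt_id w).pow 2).div_const 2
      simp at this
      exact this.hasDerivWithinAt)
    (hg.mono (by
      rintro _ ⟨w, hw, rfl⟩
      have : 0 < w := ha0.trans hw
      simp only [Set.mem_Ioi]; positivity))
    (by
      have h1 : Set.Ici (a ^ 2 / 2) ⊆ Set.Ioi 0 := by
        intro y hy
        have : 0 < a ^ 2 / 2 := by positivity
        exact this.trans_le hy
      refine gd_integrable.mono_set (subset_trans ?_ h1)
      rintro _ ⟨w, hw, rfl⟩
      have : a ≤ w := hw
      simp only [Set.mem_Ici]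
      gcongr)
    (by
      rw [integrableOn_Ici_iff_integrableOn_Ioi]
      refine IntegrableOn.congr_fun ((hint.const_mul √2).integrableOn) (fun w hw => ?_)
        measurableSet_Ioi
      exact (key w hw).symm)
  simp only [Function.comp_apply, hfa] at sub
  rw [← sub, setIntegral_congr_fun measurableSet_Ioi key, integral_const_mul, gaussTail,
    Real.sqrt_mul (by norm_num)]
  have h2 : √2 * √2 = (2:ℝ) := Real.mul_self_sqrt (by norm_num)
  have : 0 < √(2:ℝ) := by positivity
  have : 0 < √π := by positivity
  field_simp
  rw [sq, h2]

/-- bounds -/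
lemma harm_bound {u κ : ℝ} (hu : 0 < u) (hκ : 0 < κ) (hκ8 : κ ≤ 8) :
    |(harmonic ⌊8 * u / κ⌋₊ : ℝ) - Real.log (8 * u / κ)| ≤ 1 + |Real.log u| := by
  have hr : 0 < 8 * u / κ := by positivity
  have h0 := log_le_harmonic_floor (8 * u / κ) hr.le
  rw [abs_of_nonneg (by linarith)]
  rcases le_or_gt 1 (8 * u / κ) with h | h
  · have := harmonic_floor_le_one_add_log _ h
    have := abs_nonneg (Real.log u)
    linarith
  · rw [Nat.floor_eq_zero.2 h]
    have : Real.log u ≤ Real.log (8 * u / κ) := by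
      apply Real.log_le_log hu
      rw [le_div_iff₀ hκ]; nlinarith
    have := neg_abs_le (Real.log u)
    simp
    linarith

lemma harm_tendsto :
    Tendsto (fun r : ℝ => (harmonic ⌊r⌋₊ : ℝ) - Real.log r) atTop
      (nhds eulerMascheroniConstant) := by
  have h1 := Real.tendsto_harmonic_sub_log.comp (tendsto_nat_floor_atTop (α := ℝ))
  have h2 : Tendsto (fun r : ℝ => Real.log ((⌊r⌋₊ : ℝ) / r)) atTop (nhds 0) := by
    have := (tendsto_nat_floor_div_atTop (R := ℝ)).log one_ne_zero
    simpa using this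
  have h3 := h1.add h2
  rw [add_zero] at h3
  refine h3.congr' ?_
  filter_upwards [eventually_ge_atTop 1] with r hr
  have : (0:ℝ) < ⌊r⌋₊ := by exact_mod_cast Nat.floor_pos.2 hr
  simp only [Function.comp_apply]
  rw [Real.log_div this.ne' (by linarith)]
  ring

lemma harm_meas (κ : ℝ) : Measurable (fun u : ℝ => (harmonic ⌊8 * u / κ⌋₊ : ℝ)) := by
  have : Measurable (fun n : ℕ => (harmonic n : ℝ)) := measurable_from_top
  exact this.comp (Nat.measurable_floor.comp (by fun_prop))

lemma gd_meas : Measurable gd := by unfold gd; fun_prop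

lemma bound_integrable :
    IntegrableOn (fun u => (1 + |Real.log u|) * gd u) (Set.Ioi 0) := by
  have := gd_integrable.add gd_log_integrable.abs
  refine IntegrableOn.congr_fun this (fun u hu => ?_) measurableSet_Ioi
  have := gd_nonneg (u := u) hu
  simp only [Pi.add_apply, abs_mul, abs_of_nonneg this]
  ring

lemma diff_integrable {κ : ℝ} (hκ : 0 < κ) (hκ8 : κ ≤ 8) :
    IntegrableOn (fun u => ((harmonic ⌊8 * u / κ⌋₊ : ℝ) - Real.log (8 * u / κ)) * gd u)
      (Set.Ioi 0) := by
  refine Integrable.mono' bound_integrable ?_ ?_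
  · have := harm_meas κ
    have := gd_meas
    fun_prop
  · filter_upwards [ae_restrict_mem measurableSet_Ioi] with u hu
    rw [norm_mul, Real.norm_eq_abs, Real.norm_eq_abs, abs_of_nonneg (gd_nonneg hu)]
    exact mul_le_mul_of_nonneg_right (harm_bound hu hκ hκ8) (gd_nonneg hu)

lemma log_part {κ : ℝ} (hκ : 0 < κ) :
    IntegrableOn (fun u => Real.log (8 * u / κ) * gd u) (Set.Ioi 0) ∧
    ∫ u in Set.Ioi (0:ℝ), Real.log (8 * u / κ) * gd u =
      √π * (Real.log 8 - Real.log κ - (eulerMascheroniConstant + 2 * Real.log 2)) := by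
  have h : Set.EqOn (fun u => (Real.log 8 - Real.log κ) * gd u + Real.log u * gd u)
      (fun u => Real.log (8 * u / κ) * gd u) (Set.Ioi 0) := by
    intro u hu
    have hu : (0:ℝ) < u := hu
    simp only
    rw [Real.log_div (by positivity) hκ.ne', Real.log_mul (by norm_num) hu.ne']
    ring
  have i1 := gd_integrable.const_mul (Real.log 8 - Real.log κ)
  constructor
  · exact IntegrableOn.congr_fun (i1.add gd_log_integrable) h measurableSet_Ioi
  · rw [← setIntegral_congr_fun measurableSet_Ioi h, integral_add i1 gd_log_integrable,
      integral_const_mul, gd_integral, gd_log_integral]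
    ring

lemma harm_integrable {κ : ℝ} (hκ : 0 < κ) (hκ8 : κ ≤ 8) :
    IntegrableOn (fun u => (harmonic ⌊8 * u / κ⌋₊ : ℝ) * gd u) (Set.Ioi 0) := by
  refine IntegrableOn.congr_fun ((diff_integrable hκ hκ8).add (log_part hκ).1) (fun u hu => ?_)
    measurableSet_Ioi
  simp only [Pi.add_apply]
  ring

lemma sum_eq {κ : ℝ} (hκ : 0 < κ) (hκ8 : κ ≤ 8) :
    2 * ∑' n : ℕ, ((n : ℝ) + 1)⁻¹ * gaussTail (√(κ * ((n : ℝ) + 1)) / 2) =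
      (√π)⁻¹ * ∫ u in Set.Ioi (0:ℝ), (harmonic ⌊8 * u / κ⌋₊ : ℝ) * gd u := by
  let f : ℕ → ℝ → ℝ := fun n u =>
    ((n : ℝ) + 1)⁻¹ * (Set.Ici (κ * ((n : ℝ) + 1) / 8)).indicator gd u
  have hmeas : ∀ n, Measurable (f n) := fun n =>
    (gd_meas.indicator measurableSet_Ici).const_mul _
  have hsum : ∀ u ∈ Set.Ioi (0:ℝ),
      HasSum (fun n => f n u) ((harmonic ⌊8 * u / κ⌋₊ : ℝ) * gd u) := by
    intro u hu
    have hu : (0:ℝ) < u := hu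
    have hiff : ∀ n : ℕ, κ * ((n : ℝ) + 1) / 8 ≤ u ↔ n < ⌊8 * u / κ⌋₊ := by
      intro n
      rw [← Nat.succ_le_iff, Nat.le_floor_iff (by positivity), le_div_iff₀ hκ,
        div_le_iff₀ (by norm_num)]
      push_cast
      constructor <;> intro h <;> linarith
    have e : (harmonic ⌊8 * u / κ⌋₊ : ℝ) * gd u =
        ∑ n ∈ Finset.range ⌊8 * u / κ⌋₊, f n u := by
      simp only [harmonic]
      push_cast
      rw [Finset.sum_mul]
      refine Finset.sum_congr rfl fun n hn => ?_
      have : u ∈ Set.Ici (κ * ((n : ℝ) + 1) / 8) := (hiff n).2 (Finset.mem_range.1 hn)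
      simp only [f, Set.indicator_of_mem this]
    rw [e]
    refine hasSum_sum_of_ne_finset_zero fun n hn => ?_
    have : u ∉ Set.Ici (κ * ((n : ℝ) + 1) / 8) := fun h =>
      hn (Finset.mem_range.2 ((hiff n).1 h))
    simp only [f, Set.indicator_of_notMem this, mul_zero]
  have hnn : ∀ n, ∀ u ∈ Set.Ioi (0:ℝ), 0 ≤ f n u := by
    intro n u hu
    refine mul_nonneg (by positivity) ?_
    by_cases h : u ∈ Set.Ici (κ * ((n : ℝ) + 1) / 8)
    · rw [Set.indicator_of_mem h]; exact gd_nonneg hu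
    · rw [Set.indicator_of_notMem h]
  have H := hasSum_integral_of_dominated_convergence (μ := volume.restrict (Set.Ioi (0:ℝ)))
    (F := f) (f := fun u => (harmonic ⌊8 * u / κ⌋₊ : ℝ) * gd u) f
    (fun n => (hmeas n).aestronglyMeasurable)
    (fun n => by
      filter_upwards [ae_restrict_mem measurableSet_Ioi] with u hu
      rw [Real.norm_of_nonneg (hnn n u hu)])
    (by
      filter_upwards [ae_restrict_mem measurableSet_Ioi] with u hu
      exact (hsum u hu).summable)
    (by
      refine IntegrableOn.congr_fun (harm_integrable hκ hκ8) (fun u hu => ?_) measurableSet_Ioi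
      exact (hsum u hu).tsum_eq.symm)
    (by
      filter_upwards [ae_restrict_mem measurableSet_Ioi] with u hu
      exact hsum u hu)
  rw [← H.tsum_eq, ← tsum_mul_left, ← tsum_mul_left]
  refine tsum_congr fun n => ?_
  have hx : 0 < κ * ((n : ℝ) + 1) := by positivity
  have hG := gaussTail_eq hx
  have : ∫ u in Set.Ioi (0:ℝ), f n u =
      ((n : ℝ) + 1)⁻¹ * ∫ u in Set.Ioi (κ * ((n : ℝ) + 1) / 8), gd u := by
    simp only [f]
    rw [integral_const_mul, setIntegral_indicator measurableSet_Ici,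
      Set.inter_eq_self_of_subset_right, integral_Ici_eq_integral_Ioi]
    intro y hy
    have : 0 < κ * ((n : ℝ) + 1) / 8 := by positivity
    exact this.trans_le hy
  rw [this]
  linear_combination ((n : ℝ) + 1)⁻¹ * hG

lemma diff_tendsto :
    Tendsto (fun κ : ℝ => ∫ u in Set.Ioi (0:ℝ),
      ((harmonic ⌊8 * u / κ⌋₊ : ℝ) - Real.log (8 * u / κ)) * gd u)
      (nhdsWithin 0 (Set.Ioi (0 : ℝ))) (nhds (eulerMascheroniConstant * √π)) := by
  rw [← gd_integral, ← integral_const_mul]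
  have ev : ∀ᶠ κ : ℝ in nhdsWithin 0 (Set.Ioi (0 : ℝ)), 0 < κ ∧ κ ≤ 8 := by
    filter_upwards [self_mem_nhdsWithin, Ioc_mem_nhdsGT (show (0:ℝ) < 8 by norm_num)] with κ h1 h2
    exact h2
  refine tendsto_integral_filter_of_dominated_convergence
    (fun u => (1 + |Real.log u|) * gd u) ?_ ?_ bound_integrable ?_
  · filter_upwards [ev] with κ hκ
    exact (diff_integrable hκ.1 hκ.2).aestronglyMeasurable
  · filter_upwards [ev] with κ hκ
    filter_upwards [ae_restrict_mem measurableSet_Ioi] with u hu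
    rw [norm_mul, Real.norm_eq_abs, Real.norm_eq_abs, abs_of_nonneg (gd_nonneg hu)]
    exact mul_le_mul_of_nonneg_right (harm_bound hu hκ.1 hκ.2) (gd_nonneg hu)
  · filter_upwards [ae_restrict_mem measurableSet_Ioi] with u hu
    have hu : (0:ℝ) < u := hu
    refine Tendsto.mul_const _ ?_
    have ht : Tendsto (fun κ : ℝ => 8 * u / κ) (nhdsWithin 0 (Set.Ioi (0 : ℝ))) atTop := by
      simp only [div_eq_mul_inv]
      exact tendsto_inv_nhdsGT_zero.const_mul_atTop (by positivity)
    exact harm_tendsto.comp ht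

lemma F_tendsto : Tendsto F (nhdsWithin 0 (Set.Ioi (0 : ℝ))) (nhds (1 / 2)) := by
  have hpi : 0 < √π := by positivity
  have h8 : Real.log 8 = 3 * Real.log 2 := by
    rw [show (8:ℝ) = 2 ^ 3 by norm_num, Real.log_pow]; norm_num
  have h1 := (diff_tendsto.const_mul (√π)⁻¹).const_sub
    (-(Real.log 8 - (eulerMascheroniConstant + 2 * Real.log 2)))
  have h2 := (Real.continuous_exp.tendsto _).comp h1
  have e : Real.exp (-(Real.log 8 - (eulerMascheroniConstant + 2 * Real.log 2)) -
      (√π)⁻¹ * (eulerMascheroniConstant * √π)) = 1 / 2 := by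
    have : -(Real.log 8 - (eulerMascheroniConstant + 2 * Real.log 2)) -
      (√π)⁻¹ * (eulerMascheroniConstant * √π) = -Real.log 2 := by
      rw [h8]; field_simp; ring
    rw [this, Real.exp_neg, Real.exp_log (by norm_num)]; norm_num
  rw [e] at h2
  refine h2.congr' ?_
  filter_upwards [Ioc_mem_nhdsGT (show (0:ℝ) < 8 by norm_num)] with κ hκ
  have hs := sum_eq hκ.1 hκ.2
  have hd := integral_sub (harm_integrable hκ.1 hκ.2) (log_part hκ.1).1
  simp only [← sub_mul] at hd
  rw [(log_part hκ.1).2] at hd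
  have hF : F κ = Real.exp (-Real.log κ -
      2 * ∑' n : ℕ, ((n : ℝ) + 1)⁻¹ * gaussTail (√(κ * ((n : ℝ) + 1)) / 2)) := by
    rw [F, sub_eq_add_neg, Real.exp_add, Real.exp_neg, Real.exp_log hκ.1, neg_mul]
  rw [hF, hs]
  simp only [Function.comp_apply]
  rw [hd]
  congr 1
  field_simp
  ring

/-- `F(κ) → 1/2` as `κ ↓ 0`; consequently `G(h; 2d) ∼ 1/(4h²)` as `h → ∞`, i.e.
`h² G(h; 2d) → 1/4`. -/
theorem F_tendsto_half_and_G_asymptotics :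
    Tendsto F (nhdsWithin 0 (Set.Ioi (0 : ℝ))) (nhds (1 / 2)) ∧
      ∀ d : ℕ, 1 ≤ d →
        Tendsto (fun h : ℝ => h ^ 2 * G h (2 * d)) atTop (nhds (1 / 4)) := by
  refine ⟨F_tendsto, fun d hd => ?_⟩
  have hd0 : (0:ℝ) < 2 * d := by
    have : (0:ℝ) < d := by exact_mod_cast hd
    positivity
  have h1 : Tendsto (fun h : ℝ => 2 * (d:ℝ) / h) atTop (nhdsWithin 0 (Set.Ioi (0 : ℝ))) := by
    rw [tendsto_nhdsWithin_iff]
    refine ⟨tendsto_const_nhds.div_atTop tendsto_id, ?_⟩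
    filter_upwards [eventually_gt_atTop 0] with h hh
    exact div_pos hd0 hh
  have h2 := (F_tendsto.comp h1).pow 2
  rw [show ((1:ℝ) / 2) ^ 2 = 1 / 4 by norm_num] at h2
  refine h2.congr' ?_
  filter_upwards [eventually_gt_atTop 0] with h hh
  simp only [G, Function.comp_apply]
  field_simp
end
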